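/- Let α ≥ 0, β > 0 and f(k) = k/2 + (α/2)·k/log(k ∨ e) + β. Then there exists a constant c > 0, depending only on α and β, such that for every k ∈ ℕ₀, every degree evolution (Z[m,n])_{n≥m} with attachment rule f started at k, and all pairs m ≤ n with f(Z[m,l])/l ≤ 1 almost surely for m ≤ l < n: E f(Z[m,n]) ≥ c·√(n/m)·(1 ∨ log(n/m))^α. -/

import Mathlib

open MeasureTheory

/-- The attachment rule `f(k) = k/2 + (α/2)·k/log(k ∨ e) + β`. -/
noncomputable def fPA (α β : ℝ) (k : ℕ) : ℝ :=
  (k : ℝ) / 2 + α / 2 * (k : ℝ) / Real.log (max (k : ℝ) (Real.exp 1)) + β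

/-- A degree evolution with attachment rule `f`, started at time `m` in state `k`:
a Markov chain on `ℕ` with increments in `{0,1}` and conditional jump probability
`f(Z[m,n])/n` given the past. -/
structure DegreeEvolution {Ω : Type} [MeasurableSpace Ω] (μ : Measure Ω)
    (f : ℕ → ℝ) (m k : ℕ) (Z : ℕ → Ω → ℕ) : Prop where
  measurable : ∀ n, Measurable (Z n)
  init : ∀ ω, Z m ω = k
  incr : ∀ n, m ≤ n → ∀ ω, Z (n + 1) ω = Z n ω ∨ Z (n + 1) ω = Z n ω + 1
  jump : ∀ n, m ≤ n → ∀ h : ℕ → ℕ,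
    μ ({ω | Z (n + 1) ω = Z n ω + 1} ∩ {ω | ∀ i, m ≤ i → i ≤ n → Z i ω = h i})
      = ENNReal.ofReal (f (h n) / (n : ℝ)) * μ {ω | ∀ i, m ≤ i → i ≤ n → Z i ω = h i}

namespace DegreeEvolution

variable {Ω : Type} [MeasurableSpace Ω] {μ : Measure Ω} {f : ℕ → ℝ} {m k : ℕ} {Z : ℕ → Ω → ℕ}

/-- The part of a degree evolution between the times `m` and `n`. -/
def history (Z : ℕ → Ω → ℕ) (m n : ℕ) (ω : Ω) (i : Finset.Icc m n) : ℕ := Z i ω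

lemma measurable_history (hZ : DegreeEvolution μ f m k Z) (n : ℕ) :
    Measurable (history Z m n) :=
  measurable_pi_lambda _ fun i => hZ.measurable i

lemma measurableSet_jump (hZ : DegreeEvolution μ f m k Z) (n : ℕ) :
    MeasurableSet {ω | Z (n + 1) ω = Z n ω + 1} :=
  measurableSet_eq_fun (hZ.measurable _) ((hZ.measurable _).add_const 1)

/-- The conditional jump probability, integrated against a function of the present state. -/
lemma setLIntegral_jump (hZ : DegreeEvolution μ f m k Z) {n : ℕ} (hmn : m ≤ n)
    (w : ℕ → ENNReal) :
    ∫⁻ ω in {ω | Z (n + 1) ω = Z n ω + 1}, w (Z n ω) ∂μ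
      = ∫⁻ ω, ENNReal.ofReal (f (Z n ω) / n) * w (Z n ω) ∂μ := by
  set A := {ω | Z (n + 1) ω = Z n ω + 1}
  have hAm : MeasurableSet A := hZ.measurableSet_jump n
  have hH := hZ.measurable_history n
  let e : Finset.Icc m n := ⟨n, Finset.mem_Icc.2 ⟨hmn, le_rfl⟩⟩
  let d : (Finset.Icc m n → ℕ) → ENNReal := fun g => ENNReal.ofReal (f (g e) / n)
  have key : (μ.restrict A).map (history Z m n)
      = (μ.map (history Z m n)).withDensity d := by
    refine Measure.ext_of_singleton fun g => ?_
    have hs : MeasurableSet ({g} : Set (Finset.Icc m n → ℕ)) := measurableSet_singleton g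
    rw [Measure.map_apply hH hs, Measure.restrict_apply (hH hs), withDensity_apply _ hs,
      Measure.restrict_singleton, lintegral_smul_measure, lintegral_dirac,
      Measure.map_apply hH hs]
    let h : ℕ → ℕ := fun i => if hi : i ∈ Finset.Icc m n then g ⟨i, hi⟩ else 0
    have hpre : history Z m n ⁻¹' {g} = {ω | ∀ i, m ≤ i → i ≤ n → Z i ω = h i} := by
      ext ω
      simp only [Set.mem_preimage, Set.mem_singleton_iff, funext_iff, history, Subtype.forall,
        Set.mem_ofPred_eq, h, Finset.mem_Icc]
      constructor
      · intro H i h1 h2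
        rw [dif_pos ⟨h1, h2⟩]
        exact H i ⟨h1, h2⟩
      · intro H i hi
        have := H i hi.1 hi.2
        rwa [dif_pos hi] at this
    have hn : h n = g e := dif_pos (Finset.mem_Icc.2 ⟨hmn, le_rfl⟩)
    rw [hpre, Set.inter_comm, hZ.jump n hmn h, hn, smul_eq_mul, mul_comm]
  have h1 : ∫⁻ g : Finset.Icc m n → ℕ, w (g e) ∂((μ.restrict A).map (history Z m n))
      = ∫⁻ ω in A, w (Z n ω) ∂μ :=
    lintegral_map (f := fun g => w (g e)) (measurable_of_countable _) hH
  have h2 : ∫⁻ g, (d * fun g : Finset.Icc m n → ℕ => w (g e)) g ∂(μ.map (history Z m n))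
      = ∫⁻ ω, ENNReal.ofReal (f (Z n ω) / n) * w (Z n ω) ∂μ :=
    lintegral_map (f := d * fun g => w (g e)) (measurable_of_countable _) hH
  rw [← h1, ← h2, key]
  exact lintegral_withDensity_eq_lintegral_mul _ (measurable_of_countable _)
    (measurable_of_countable _)

lemma le_add_sub (hZ : DegreeEvolution μ f m k Z) {n : ℕ} (hmn : m ≤ n) (ω : Ω) :
    Z n ω ≤ k + (n - m) := by
  induction n, hmn using Nat.le_induction with
  | base => simp [hZ.init ω]
  | succ n hmn ih => have := hZ.incr n hmn ω; omega

lemma integrable_comp [IsFiniteMeasure μ] (hZ : DegreeEvolution μ f m k Z) {n : ℕ} (hmn : m ≤ n)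
    (g : ℕ → ℝ) : Integrable (fun ω => g (Z n ω)) μ := by
  refine Integrable.of_bound
    ((measurable_of_countable g).comp (hZ.measurable n)).aestronglyMeasurable
    (∑ j ∈ Finset.range (k + (n - m) + 1), ‖g j‖) (Filter.Eventually.of_forall fun ω => ?_)
  exact Finset.single_le_sum (f := fun j => ‖g j‖) (fun _ _ => norm_nonneg _)
    (Finset.mem_range.2 (Nat.lt_succ_of_le (hZ.le_add_sub hmn ω)))

end DegreeEvolution

/-- The function `V` with `V 0 = 1` and `f (V (· + 1) - V) = V / 2`, so that
`V (Z[m,n]) / ∏ (1 + 1 / (2 l))` is a martingale for every degree evolution with rule `f`. -/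
noncomputable def halfHarmonic (f : ℕ → ℝ) (k : ℕ) : ℝ :=
  ∏ j ∈ Finset.range k, (1 + 1 / (2 * f j))

section halfHarmonic

variable {f : ℕ → ℝ}

lemma halfHarmonic_succ (f : ℕ → ℝ) (k : ℕ) :
    halfHarmonic f (k + 1) = halfHarmonic f k * (1 + 1 / (2 * f k)) :=
  Finset.prod_range_succ _ _

lemma one_le_halfHarmonic (hf : ∀ j, 0 < f j) (k : ℕ) : 1 ≤ halfHarmonic f k := by
  induction k with
  | zero => simp [halfHarmonic]
  | succ k ih =>
    rw [halfHarmonic_succ]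
    have : 0 < 1 / (2 * f k) := by have := hf k; positivity
    nlinarith

lemma halfHarmonic_monotone (hf : ∀ j, 0 < f j) : Monotone (halfHarmonic f) := by
  refine monotone_nat_of_le_succ fun k => ?_
  rw [halfHarmonic_succ]
  have : 0 < 1 / (2 * f k) := by have := hf k; positivity
  nlinarith [one_le_halfHarmonic hf k]

lemma DegreeEvolution.lintegral_halfHarmonic_succ {Ω : Type} [MeasurableSpace Ω] {μ : Measure Ω}
    {m k : ℕ} {Z : ℕ → Ω → ℕ} (hf : ∀ j, 0 < f j) (hZ : DegreeEvolution μ f m k Z)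
    {n : ℕ} (hmn : m ≤ n) :
    ∫⁻ ω, ENNReal.ofReal (halfHarmonic f (Z (n + 1) ω)) ∂μ
      = ENNReal.ofReal (1 + 1 / (2 * n))
        * ∫⁻ ω, ENNReal.ofReal (halfHarmonic f (Z n ω)) ∂μ := by
  have hV : ∀ j, 0 < halfHarmonic f j := fun j => one_pos.trans_le (one_le_halfHarmonic hf j)
  set w : ℕ → ENNReal := fun j => ENNReal.ofReal (halfHarmonic f j / (2 * f j))
  have hm : ∀ g : ℕ → ENNReal, Measurable fun ω => g (Z n ω) := fun g =>
    (measurable_of_countable g).comp (hZ.measurable n)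
  have hsplit : ∀ ω, ENNReal.ofReal (halfHarmonic f (Z (n + 1) ω))
      = ENNReal.ofReal (halfHarmonic f (Z n ω))
        + {ω | Z (n + 1) ω = Z n ω + 1}.indicator (fun ω => w (Z n ω)) ω := by
    intro ω
    rcases hZ.incr n hmn ω with h | h
    · rw [Set.indicator_of_notMem (by simp [h]), add_zero, h]
    · rw [Set.indicator_of_mem (by simpa using h), h, halfHarmonic_succ, ← ENNReal.ofReal_add
        (hV _).le (div_nonneg (hV _).le (by have := hf (Z n ω); positivity))]
      congr 1
      ring
  simp_rw [hsplit]
  rw [lintegral_add_left (hm fun j => ENNReal.ofReal (halfHarmonic f j)),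
    lintegral_indicator (hZ.measurableSet_jump n), hZ.setLIntegral_jump hmn w,
    ENNReal.ofReal_add zero_le_one (by positivity), add_mul, ENNReal.ofReal_one, one_mul,
    ← lintegral_const_mul _ (hm fun j => ENNReal.ofReal (halfHarmonic f j))]
  congr 1
  refine lintegral_congr fun ω => ?_
  have := hf (Z n ω)
  rw [← ENNReal.ofReal_mul (by positivity), ← ENNReal.ofReal_mul (by positivity)]
  congr 1
  field_simp

lemma DegreeEvolution.sqrt_le_integral_halfHarmonic {Ω : Type} [MeasurableSpace Ω]
    {μ : Measure Ω} [IsProbabilityMeasure μ] {m k : ℕ} {Z : ℕ → Ω → ℕ} (hf : ∀ j, 0 < f j)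
    (hZ : DegreeEvolution μ f m k Z) (hm : 1 ≤ m) {n : ℕ} (hmn : m ≤ n) :
    Real.sqrt ((n : ℝ) / m) ≤ ∫ ω, halfHarmonic f (Z n ω) ∂μ := by
  have hV : ∀ j, 0 ≤ halfHarmonic f j := fun j => zero_le_one.trans (one_le_halfHarmonic hf j)
  rw [← ENNReal.ofReal_le_ofReal_iff (integral_nonneg fun ω => hV _),
    ofReal_integral_eq_lintegral_ofReal (hZ.integrable_comp hmn _)
      (Filter.Eventually.of_forall fun ω => hV _)]
  induction n, hmn using Nat.le_induction with
  | base =>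
    have : (m : ℝ) ≠ 0 := by positivity
    simp only [hZ.init, lintegral_const, measure_univ, mul_one, div_self this, Real.sqrt_one]
    exact ENNReal.ofReal_le_ofReal (one_le_halfHarmonic hf k)
  | succ n hmn ih =>
    rw [hZ.lintegral_halfHarmonic_succ hf hmn]
    refine le_trans ?_ (mul_le_mul_right ih _)
    have hn : (0 : ℝ) < n := by exact_mod_cast hm.trans hmn
    have hm' : (0 : ℝ) < m := by exact_mod_cast hm
    rw [← ENNReal.ofReal_mul (by positivity)]
    refine ENNReal.ofReal_le_ofReal ?_
    rw [← Real.sqrt_sq (show (0 : ℝ) ≤ 1 + 1 / (2 * n) by positivity),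
      ← Real.sqrt_mul (by positivity)]
    refine Real.sqrt_le_sqrt ?_
    have : (1 + 1 / (2 * (n : ℝ))) ^ 2 * (n / m) = ((n + 1 : ℕ) : ℝ) / m + 1 / (4 * n * m) := by
      push_cast
      field_simp
      ring
    rw [this]
    have : 0 < 1 / (4 * (n : ℝ) * m) := by positivity
    linarith

end halfHarmonic

section fPA

variable {α β : ℝ}

lemma one_le_log_max_exp (x : ℝ) : 1 ≤ Real.log (max x (Real.exp 1)) := by
  rw [Real.le_log_iff_exp_le (lt_max_of_lt_right (Real.exp_pos 1))]
  exact le_max_right _ _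

lemma half_add_le_fPA (hα : 0 ≤ α) (k : ℕ) : (k : ℝ) / 2 + β ≤ fPA α β k := by
  have := one_le_log_max_exp (k : ℝ)
  have : 0 ≤ α / 2 * (k : ℝ) / Real.log (max (k : ℝ) (Real.exp 1)) := by positivity
  unfold fPA
  linarith

lemma fPA_pos (hα : 0 ≤ α) (hβ : 0 < β) (k : ℕ) : 0 < fPA α β k :=
  lt_of_lt_of_le (by positivity) (half_add_le_fPA hα k)

/-- The derivative of `log x - α log (log x + α)`. -/
lemma hasDerivAt_log_sub_log_log (hα : 0 ≤ α) {x : ℝ} (hx : Real.exp 1 ≤ x) :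
    HasDerivAt (fun x => Real.log x - α * Real.log (Real.log x + α))
      (1 / (x + α * (x / Real.log x))) x := by
  have hx0 : 0 < x := (Real.exp_pos 1).trans_le hx
  have hl : 1 ≤ Real.log x := (Real.le_log_iff_exp_le hx0).2 hx
  have h1 := Real.hasDerivAt_log hx0.ne'
  have h2 := (h1.add_const α).log (by positivity)
  refine (h1.sub (h2.const_mul α)).congr_deriv ?_
  field_simp
  ring

lemma one_div_fPA_le (hα : 0 ≤ α) (hβ : 0 < β) {j : ℕ} (hj : 3 ≤ j) :
    1 / (2 * fPA α β (j + 1)) ≤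
      (Real.log (j + 1 : ℕ) - α * Real.log (Real.log (j + 1 : ℕ) + α))
        - (Real.log j - α * Real.log (Real.log j + α)) := by
  have he : Real.exp 1 ≤ j := by
    have : (3 : ℝ) ≤ j := by exact_mod_cast hj
    linarith [Real.exp_one_lt_d9]
  have hlt : (j : ℝ) < (j + 1 : ℕ) := by push_cast; linarith
  obtain ⟨x, ⟨hx1, hx2⟩, hx⟩ := exists_hasDerivAt_eq_slope
    (fun x => Real.log x - α * Real.log (Real.log x + α)) (fun x => 1 / (x + α * (x / Real.log x)))
    hlt (fun x hx => (hasDerivAt_log_sub_log_log hα (he.trans hx.1)).continuousAt.continuousWithinAt)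
    (fun x hx => hasDerivAt_log_sub_log_log hα (he.trans hx.1.le))
  have h1 : ((j + 1 : ℕ) : ℝ) - j = 1 := by push_cast; ring
  rw [h1, div_one] at hx
  rw [← hx]
  have hxe := he.trans hx1.le
  have hx0 : 0 < x := (Real.exp_pos 1).trans_le hxe
  have hl : 1 ≤ Real.log x := (Real.le_log_iff_exp_le hx0).2 hxe
  have hje : Real.exp 1 ≤ (j + 1 : ℕ) := he.trans hlt.le
  have hj0 : (0 : ℝ) < (j + 1 : ℕ) := by positivity
  have hlj : 1 ≤ Real.log (j + 1 : ℕ) := (Real.le_log_iff_exp_le hj0).2 hje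
  have hanti : x / Real.log x ≤ (j + 1 : ℕ) / Real.log (j + 1 : ℕ) := by
    have := Real.log_div_self_antitoneOn (show Real.exp 1 ≤ x from hxe) hje hx2.le
    rw [← inv_div (Real.log x), ← inv_div (Real.log _)]
    exact inv_anti₀ (by positivity) this
  refine one_div_le_one_div_of_le (by positivity) ?_
  have h2 : 2 * fPA α β (j + 1)
      = (j + 1 : ℕ) + α * ((j + 1 : ℕ) / Real.log (j + 1 : ℕ)) + 2 * β := by
    rw [fPA, max_eq_left hje]
    ring
  rw [h2]
  have := mul_le_mul_of_nonneg_left hanti hα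
  linarith

lemma exists_halfHarmonic_fPA_le (hα : 0 ≤ α) (hβ : 0 < β) :
    ∃ C : ℝ, 0 < C ∧ ∀ k : ℕ, 3 ≤ k →
      halfHarmonic (fPA α β) k * Real.log k ^ α ≤ C * k := by
  have hf := fPA_pos hα hβ
  set V := halfHarmonic (fPA α β)
  have hV : ∀ j, 0 < V j := fun j => one_pos.trans_le (one_le_halfHarmonic hf j)
  set Ψ : ℕ → ℝ := fun k => Real.log k - α * Real.log (Real.log k + α)
  set C := V 4 / Real.exp (Ψ 3)
  have hC : 0 < C := div_pos (hV 4) (Real.exp_pos _)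
  refine ⟨C, hC, fun k hk => ?_⟩
  have hmain : V (k + 1) ≤ C * Real.exp (Ψ k) := by
    induction k, hk using Nat.le_induction with
    | base => exact (div_mul_cancel₀ _ (Real.exp_pos _).ne').ge
    | succ k hk ih =>
      have h1 : 1 + 1 / (2 * fPA α β (k + 1)) ≤ Real.exp (Ψ (k + 1) - Ψ k) := by
        rw [add_comm]
        exact (Real.add_one_le_exp _).trans (Real.exp_le_exp.2 (one_div_fPA_le hα hβ hk))
      calc V (k + 1 + 1) = V (k + 1) * (1 + 1 / (2 * fPA α β (k + 1))) := halfHarmonic_succ _ _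
        _ ≤ (C * Real.exp (Ψ k)) * Real.exp (Ψ (k + 1) - Ψ k) := by
          refine mul_le_mul ih h1 ?_ (by positivity)
          have := hf (k + 1)
          positivity
        _ = C * Real.exp (Ψ (k + 1)) := by
          rw [mul_assoc, ← Real.exp_add, add_sub_cancel]
  have hk0 : (0 : ℝ) < k := by positivity
  have hlog : 0 < Real.log k := Real.log_pos (by exact_mod_cast (by omega : 1 < k))
  have hexp : Real.exp (Ψ k) * (Real.log k + α) ^ α = k := by
    rw [Real.rpow_def_of_pos (by positivity), ← Real.exp_add, mul_comm _ α, sub_add_cancel,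
      Real.exp_log hk0]
  calc V k * Real.log k ^ α ≤ (C * Real.exp (Ψ k)) * (Real.log k + α) ^ α := by
        refine mul_le_mul ((halfHarmonic_monotone hf k.le_succ).trans hmain)
          (Real.rpow_le_rpow hlog.le (by linarith) hα) (by positivity) (by positivity)
    _ = C * k := by rw [mul_assoc, hexp]

/-- Linear lower bound of `fPA` in terms of `halfHarmonic`, with a truncation level `T`. -/
lemma exists_mul_halfHarmonic_sub_le_fPA (hα : 0 ≤ α) (hβ : 0 < β) :
    ∃ C : ℝ, 0 < C ∧ ∀ T : ℝ, 3 ≤ T → ∀ k : ℕ,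
      Real.log T ^ α * (halfHarmonic (fPA α β) k - C * T) ≤ C * fPA α β k := by
  obtain ⟨C, hC, hle⟩ := exists_halfHarmonic_fPA_le hα hβ
  have hf := fPA_pos hα hβ
  refine ⟨2 * C, by positivity, fun T hT k => ?_⟩
  have hlT : 0 ≤ Real.log T := Real.log_nonneg (by linarith)
  have hf2 := half_add_le_fPA (β := β) hα k
  have hTα : 0 ≤ Real.log T ^ α := by positivity
  rcases le_or_gt (k : ℝ) T with hkT | hkT
  · have hlin : ∀ j : ℕ, 3 ≤ j → halfHarmonic (fPA α β) j ≤ C * j := by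
      intro j hj
      have hj3 : (3 : ℝ) ≤ j := by exact_mod_cast hj
      have hl : 1 ≤ Real.log j := by
        rw [Real.le_log_iff_exp_le (by linarith)]
        linarith [Real.exp_one_lt_d9]
      exact (le_mul_of_one_le_right (zero_le_one.trans (one_le_halfHarmonic hf j))
        (Real.one_le_rpow hl hα)).trans (hle j hj)
    have hV : halfHarmonic (fPA α β) k ≤ C * T := by
      refine (halfHarmonic_monotone hf (le_max_left k 3)).trans
        ((hlin _ (le_max_right k 3)).trans ?_)
      push_cast
      exact mul_le_mul_of_nonneg_left (max_le hkT hT) hC.le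
    refine (mul_nonpos_of_nonneg_of_nonpos hTα ?_).trans (by have := hf k; positivity)
    nlinarith
  · have hk3 : 3 ≤ k := by exact_mod_cast hT.trans hkT.le
    have hV := one_le_halfHarmonic hf k
    calc Real.log T ^ α * (halfHarmonic (fPA α β) k - 2 * C * T)
        ≤ Real.log T ^ α * halfHarmonic (fPA α β) k := by
          refine mul_le_mul_of_nonneg_left ?_ hTα
          have : 0 < 2 * C * T := by positivity
          linarith
      _ ≤ Real.log k ^ α * halfHarmonic (fPA α β) k := by
          refine mul_le_mul_of_nonneg_right ?_ (by linarith)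
          exact Real.rpow_le_rpow hlT (Real.log_le_log (by linarith) hkT.le) hα
      _ ≤ C * k := by rw [mul_comm]; exact hle k hk3
      _ ≤ 2 * C * fPA α β k := by nlinarith

end fPA

theorem stmt6 (α β : ℝ) (hα : 0 ≤ α) (hβ : 0 < β) :
    ∃ c : ℝ, 0 < c ∧
      ∀ k : ℕ, ∀ (Ω : Type) (_ : MeasurableSpace Ω) (μ : Measure Ω), IsProbabilityMeasure μ →
        ∀ m n : ℕ, 1 ≤ m → m ≤ n →
          ∀ Z : ℕ → Ω → ℕ, DegreeEvolution μ (fPA α β) m k Z →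
            (∀ l, m ≤ l → l < n → ∀ᵐ ω ∂μ, fPA α β (Z l ω) ≤ (l : ℝ)) →
              c * Real.sqrt ((n : ℝ) / (m : ℝ)) * (max 1 (Real.log ((n : ℝ) / (m : ℝ)))) ^ α
                ≤ ∫ ω, fPA α β (Z n ω) ∂μ := by
  obtain ⟨C, hC, hle⟩ := exists_mul_halfHarmonic_sub_le_fPA hα hβ
  have hf := fPA_pos hα hβ
  -- Above `R`, the truncation at `T = √√(n / m)` costs at most half of `√(n / m)`.
  set R : ℝ := max 3 (2 * C) ^ 4
  have hR3 : (3 : ℝ) ≤ max 3 (2 * C) := le_max_left _ _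
  set B := Real.sqrt R * (max 1 (Real.log R)) ^ α
  have hB : 0 < B := by positivity
  set c₂ : ℝ := (1 / 4) ^ α / (2 * C)
  have hc₂ : 0 < c₂ := by positivity
  refine ⟨min (β / B) c₂, by positivity, fun k Ω _ μ _ m n hm hmn Z hZ _ => ?_⟩
  set N : ℝ := (n : ℝ) / m
  have hN0 : 0 < N := div_pos (by exact_mod_cast hm.trans hmn) (by exact_mod_cast hm)
  set L : ℝ := max 1 (Real.log N)
  have hL0 : 0 < L := lt_max_of_lt_left one_pos
  have hLα : 0 < L ^ α := by positivity
  rcases le_or_gt N R with hNR | hNR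
  · have hbd : Real.sqrt N * L ^ α ≤ B :=
      mul_le_mul (Real.sqrt_le_sqrt hNR) (Real.rpow_le_rpow hL0.le
        (max_le_max le_rfl (Real.log_le_log hN0 hNR)) hα) hLα.le (Real.sqrt_nonneg _)
    calc min (β / B) c₂ * Real.sqrt N * L ^ α = min (β / B) c₂ * (Real.sqrt N * L ^ α) := by ring
      _ ≤ β / B * B := mul_le_mul (min_le_left _ _) hbd (by positivity) (by positivity)
      _ = ∫ _, β ∂μ := by simp [hB.ne']
      _ ≤ ∫ ω, fPA α β (Z n ω) ∂μ := by
        refine integral_mono (integrable_const _) (hZ.integrable_comp hmn _) fun ω => ?_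
        have := half_add_le_fPA (β := β) hα (Z n ω)
        have : (0 : ℝ) ≤ (Z n ω : ℝ) / 2 := by positivity
        simp only
        linarith
  · set T : ℝ := Real.sqrt (Real.sqrt N) with hT
    have hTT : T ^ 2 = Real.sqrt N := Real.sq_sqrt (Real.sqrt_nonneg _)
    have hRT : max 3 (2 * C) ≤ T := by
      refine Real.le_sqrt_of_sq_le (Real.le_sqrt_of_sq_le ?_)
      rw [← pow_mul]
      exact hNR.le
    have hT3 : 3 ≤ T := hR3.trans hRT
    have hTC : 2 * C ≤ T := (le_max_right _ _).trans hRT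
    have hlogT : Real.log T = 1 / 4 * Real.log N := by
      rw [hT, Real.log_sqrt (Real.sqrt_nonneg _), Real.log_sqrt hN0.le]
      ring
    have hLN : L = Real.log N := by
      refine max_eq_right ?_
      rw [Real.le_log_iff_exp_le hN0]
      have : (3 : ℝ) ^ 4 ≤ R := pow_le_pow_left₀ (by norm_num) hR3 4
      linarith [Real.exp_one_lt_d9]
    have hTα : Real.log T ^ α = (1 / 4) ^ α * L ^ α := by
      rw [hlogT, ← hLN, Real.mul_rpow (by norm_num) hL0.le]
    have hint : Real.log T ^ α * (Real.sqrt N - C * T) ≤ C * ∫ ω, fPA α β (Z n ω) ∂μ := by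
      have hi := hZ.integrable_comp hmn (halfHarmonic (fPA α β))
      calc Real.log T ^ α * (Real.sqrt N - C * T)
          ≤ Real.log T ^ α * ((∫ ω, halfHarmonic (fPA α β) (Z n ω) ∂μ) - C * T) := by
            refine mul_le_mul_of_nonneg_left ?_ (by rw [hTα]; positivity)
            exact sub_le_sub_right (hZ.sqrt_le_integral_halfHarmonic hf hm hmn) _
        _ = ∫ ω, Real.log T ^ α * (halfHarmonic (fPA α β) (Z n ω) - C * T) ∂μ := by
            rw [integral_const_mul, integral_sub hi (integrable_const _)]
            simp
        _ ≤ ∫ ω, C * fPA α β (Z n ω) ∂μ :=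
            integral_mono ((hi.sub (integrable_const _)).const_mul _)
              ((hZ.integrable_comp hmn _).const_mul _) fun ω => hle T hT3 _
        _ = C * ∫ ω, fPA α β (Z n ω) ∂μ := integral_const_mul _ _
    have hhalf : Real.sqrt N / 2 ≤ Real.sqrt N - C * T := by
      rw [← hTT]
      nlinarith
    rw [hTα] at hint
    have h1 : (1 / 4) ^ α * L ^ α * (Real.sqrt N / 2) ≤ C * ∫ ω, fPA α β (Z n ω) ∂μ :=
      (mul_le_mul_of_nonneg_left hhalf (by positivity)).trans hint
    calc min (β / B) c₂ * Real.sqrt N * L ^ α ≤ c₂ * Real.sqrt N * L ^ α := by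
          gcongr
          exact min_le_right _ _
      _ = ((1 / 4) ^ α * L ^ α * (Real.sqrt N / 2)) / C := by
          simp only [c₂]
          field_simp
      _ ≤ ∫ ω, fPA α β (Z n ω) ∂μ := by
          rw [div_le_iff₀ hC, mul_comm _ C]
          exact h1
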